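/- The differential of C preserves the ideal generated by h₇ and ω₂ω₆ − ½ω₄², and the induced ℚ-linear map ρ : C → S, determined on monomials by ρ(h₃^α h₇ ω₂^i ω₄^j ω₆^k) = 0 and ρ(h₃^α ω₂^i ω₄^j ω₆^k) = 2^{⌊j/2⌋} · h₃^α ω₂^{i+⌊j/2⌋} ω₆^{k+⌊j/2⌋} ω₄^{(j mod 2)} (using the reduction ω₄² = 2 ω₂ ω₆ in S), is a cochain map (ρ ∘ d = d ∘ ρ) and a quasi-isomorphism: it induces an isomorphism H^n(C) → H^n(S) for every integer n. (This exhibits S as a minimal DG-module model over ℚ[h₃] for the underlying DG-module of the minimal Sullivan model of the cyclification Cyc(S⁴).) -/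

import Mathlib

/-!
# Statement 11

The map `ρ : C → S` induced by killing `h₇` and reducing `ω₄² = 2 ω₂ ω₆` is a cochain
map and a quasi-isomorphism; in particular the differential of `C` preserves the ideal
generated by `h₇` and `ω₂ω₆ − ½ω₄²` (which is the degreewise kernel of `ρ`).

`C` is the free graded-commutative ℚ-algebra on `ω₂, ω₄, ω₆, h₃, h₇`; it is presented
here by its monomial basis `h₃^α h₇^β ω₂^i ω₄^j ω₆^k` (`α, β ∈ {0,1}`), with the
differential given by the unique degree `+1` graded derivation with
`d h₃ = 0, d ω₂ = 0, d ω₄ = h₃ ω₂, d ω₆ = h₃ ω₄, d h₇ = −½ ω₄² + ω₂ ω₆`, evaluated on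
the monomial basis.  Both complexes are concentrated in non-negative degrees, indexed
by `ℕ`.  "Quasi-isomorphism" is rendered by the (equivalent) elementary conditions of
surjectivity and injectivity on cohomology classes in every degree; in degree `0`
there are no coboundaries.
-/

noncomputable section

namespace Stmt11

/-! ## The complex `C` -/

/-- Index for the monomial basis of `C`: `(α, β, i, j, k)` encodes
`h₃^α h₇^β ω₂^i ω₄^j ω₆^k`, of degree `3α + 7β + 2i + 4j + 6k`. -/
abbrev CIdx : Type := Bool × Bool × ℕ × ℕ × ℕ

/-- Degree of a monomial of `C`. -/
def Cdeg : CIdx → ℕ := fun q =>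
  3 * q.1.toNat + 7 * q.2.1.toNat + 2 * q.2.2.1 + 4 * q.2.2.2.1 + 6 * q.2.2.2.2

/-- Basis of the degree-`n` component of `C`. -/
abbrev CB (n : ℕ) : Type := {q : CIdx // Cdeg q = n}

/-- The degree-`n` component of `C`. -/
abbrev CV (n : ℕ) : Type := CB n →₀ ℚ

/-- Contribution of `d h₇ ∋ −½ ω₄²` to the differential of a monomial:
`h₃^α h₇ X ↦ (−1)^α · (−½) · h₃^α ω₄² X`. -/
def Cterm1 (n : ℕ) : CB n → CV (n + 1) := fun b =>
  match b with
  | ⟨(α, true, i, j, k), h⟩ =>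
      (if α then (1 / 2 : ℚ) else (-(1 / 2) : ℚ)) •
        Finsupp.single ⟨(α, false, i, j + 2, k), by simp [Cdeg] at h ⊢; omega⟩ 1
  | ⟨(_, false, _, _, _), _⟩ => 0

/-- Contribution of `d h₇ ∋ ω₂ ω₆` to the differential of a monomial:
`h₃^α h₇ X ↦ (−1)^α · h₃^α ω₂ ω₆ X`. -/
def Cterm2 (n : ℕ) : CB n → CV (n + 1) := fun b =>
  match b with
  | ⟨(α, true, i, j, k), h⟩ =>
      (if α then (-1 : ℚ) else (1 : ℚ)) •
        Finsupp.single ⟨(α, false, i + 1, j, k + 1), by simp [Cdeg] at h ⊢; omega⟩ 1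
  | ⟨(_, false, _, _, _), _⟩ => 0

/-- Contribution of `d ω₄ = h₃ ω₂` to the differential of a monomial (nonzero only
when `α = 0`): `h₇^β ω₂^i ω₄^{j+1} ω₆^k ↦ (j+1) h₃ h₇^β ω₂^{i+1} ω₄^j ω₆^k`. -/
def Cterm3 (n : ℕ) : CB n → CV (n + 1) := fun b =>
  match b with
  | ⟨(false, β, i, j + 1, k), h⟩ =>
      ((j : ℚ) + 1) •
        Finsupp.single ⟨(true, β, i + 1, j, k), by simp [Cdeg] at h ⊢; omega⟩ 1
  | _ => 0

/-- Contribution of `d ω₆ = h₃ ω₄` to the differential of a monomial (nonzero only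
when `α = 0`): `h₇^β ω₂^i ω₄^j ω₆^{k+1} ↦ (k+1) h₃ h₇^β ω₂^i ω₄^{j+1} ω₆^k`. -/
def Cterm4 (n : ℕ) : CB n → CV (n + 1) := fun b =>
  match b with
  | ⟨(false, β, i, j, k + 1), h⟩ =>
      ((k : ℚ) + 1) •
        Finsupp.single ⟨(true, β, i, j + 1, k), by simp [Cdeg] at h ⊢; omega⟩ 1
  | _ => 0

/-- The differential of `C` on basis monomials: the unique degree `+1` graded
derivation with `d h₃ = 0`, `d ω₂ = 0`, `d ω₄ = h₃ ω₂`, `d ω₆ = h₃ ω₄`,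
`d h₇ = −½ ω₄² + ω₂ ω₆`, evaluated on monomials. -/
def CdTarget (n : ℕ) : CB n → CV (n + 1) := fun b =>
  Cterm1 n b + Cterm2 n b + Cterm3 n b + Cterm4 n b

/-- The differential of `C`. -/
def Cd (n : ℕ) : CV n →ₗ[ℚ] CV (n + 1) :=
  Finsupp.linearCombination ℚ (CdTarget n)

/-! ## The complex `S` -/

/-- Index for the basis of `S`: `(knd, ε, j, m)`; `knd = false` encodes
`h₃^ε ω₂^j ω₆^m` (degree `3ε + 2j + 6m`), and `knd = true` encodes
`h₃^ε ω₂^j ω₆^m ω₄` (degree `3ε + 2j + 6m + 4`). -/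
abbrev SIdx : Type := Bool × Bool × ℕ × ℕ

/-- Degree of a basis symbol of `S`. -/
def Sdeg : SIdx → ℕ :=
  fun q => 3 * q.2.1.toNat + 2 * q.2.2.1 + 6 * q.2.2.2 + 4 * q.1.toNat

/-- Basis of the degree-`n` component of `S`. -/
abbrev SB (n : ℕ) : Type := {q : SIdx // Sdeg q = n}

/-- The degree-`n` component of `S`. -/
abbrev SV (n : ℕ) : Type := SB n →₀ ℚ

/-- The differential of `S` on basis elements:
`d(ω₂^j) = 0`, `d(ω₂^j ω₆^m) = m h₃ ω₂^j ω₆^{m−1} ω₄` for `m ≥ 1`,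
`d(ω₂^j ω₆^m ω₄) = (2m+1) h₃ ω₂^{j+1} ω₆^m`, `d(h₃ ⬝) = 0`. -/
def SdTarget (n : ℕ) : SB n → SV (n + 1) := fun b =>
  match b with
  | ⟨(false, false, _, 0), _⟩ => 0
  | ⟨(false, false, j, m + 1), h⟩ =>
      ((m : ℚ) + 1) •
        Finsupp.single ⟨(true, true, j, m), by simp [Sdeg] at h ⊢; omega⟩ 1
  | ⟨(true, false, j, m), h⟩ =>
      (2 * (m : ℚ) + 1) •
        Finsupp.single ⟨(false, true, j + 1, m), by simp [Sdeg] at h ⊢; omega⟩ 1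
  | ⟨(_, true, _, _), _⟩ => 0

/-- The differential of `S`. -/
def Sd (n : ℕ) : SV n →ₗ[ℚ] SV (n + 1) :=
  Finsupp.linearCombination ℚ (SdTarget n)

/-! ## The map `ρ` -/

/-- `ρ` on basis monomials: `ρ(h₃^α h₇ ⬝) = 0` and
`ρ(h₃^α ω₂^i ω₄^j ω₆^k) = 2^{⌊j/2⌋} · h₃^α ω₂^{i+⌊j/2⌋} ω₆^{k+⌊j/2⌋} ω₄^{j mod 2}`
(using the reduction `ω₄² = 2 ω₂ ω₆` in `S`). -/
def rhoTarget (n : ℕ) : CB n → SV n := fun b =>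
  match b with
  | ⟨(_, true, _, _, _), _⟩ => 0
  | ⟨(α, false, i, j, k), h⟩ =>
      if hj : j % 2 = 1 then
        ((2 : ℚ) ^ (j / 2)) •
          Finsupp.single ⟨(true, α, i + j / 2, k + j / 2), by
            simp [Cdeg, Sdeg] at h ⊢; omega⟩ 1
      else
        ((2 : ℚ) ^ (j / 2)) •
          Finsupp.single ⟨(false, α, i + j / 2, k + j / 2), by
            simp [Cdeg, Sdeg] at h ⊢; omega⟩ 1

/-- The ℚ-linear map `ρ : C → S` (degreewise). -/
def rho (n : ℕ) : CV n →ₗ[ℚ] SV n :=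
  Finsupp.linearCombination ℚ (rhoTarget n)

/-! ## Proof -/

/-- The monomial `q` in degree `n` (zero if the degree does not match). -/
def mC (n : ℕ) (q : CIdx) : CV n :=
  if h : Cdeg q = n then Finsupp.single ⟨q, h⟩ 1 else 0

/-- The basis symbol `q` of `S` in degree `n` (zero if the degree does not match). -/
def mS (n : ℕ) (q : SIdx) : SV n :=
  if h : Sdeg q = n then Finsupp.single ⟨q, h⟩ 1 else 0

lemma mC_of {n : ℕ} {q : CIdx} (h : Cdeg q = n) : mC n q = Finsupp.single ⟨q, h⟩ 1 := dif_pos h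
lemma mC_ne {n : ℕ} {q : CIdx} (h : Cdeg q ≠ n) : mC n q = 0 := dif_neg h
lemma mS_of {n : ℕ} {q : SIdx} (h : Sdeg q = n) : mS n q = Finsupp.single ⟨q, h⟩ 1 := dif_pos h
lemma mS_ne {n : ℕ} {q : SIdx} (h : Sdeg q ≠ n) : mS n q = 0 := dif_neg h

lemma C_ind {n : ℕ} {P : CV n → Prop} (h0 : P 0) (ha : ∀ x y, P x → P y → P (x + y))
    (hs : ∀ (c : ℚ) x, P x → P (c • x)) (hm : ∀ q, P (mC n q)) (x : CV n) : P x := by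
  induction x using Finsupp.induction_linear with
  | zero => exact h0
  | add x y hx hy => exact ha x y hx hy
  | single b c =>
    have : (Finsupp.single b c : CV n) = c • mC n b.1 := by
      rw [mC_of b.2]; simp
    rw [this]; exact hs _ _ (hm _)

lemma C_ext {n : ℕ} {V : Type*} [AddCommGroup V] [Module ℚ V] (f g : CV n →ₗ[ℚ] V)
    (h : ∀ q, f (mC n q) = g (mC n q)) (x : CV n) : f x = g x := by
  refine C_ind (P := fun x => f x = g x) (by simp) ?_ ?_ h x
  · intro x y hx hy; simp [hx, hy]
  · intro c x hx; simp [hx]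

lemma S_ext {n : ℕ} {V : Type*} [AddCommGroup V] [Module ℚ V] (f g : SV n →ₗ[ℚ] V)
    (h : ∀ q, f (mS n q) = g (mS n q)) (x : SV n) : f x = g x := by
  have : f = g := by
    refine Finsupp.lhom_ext' fun b => LinearMap.ext_ring ?_
    have := h b.1
    rw [mS_of b.2] at this
    simpa using this
  rw [this]

lemma Cd_tf (n i j k : ℕ) : Cd n (mC n (true, false, i, j, k)) = 0 := by
  by_cases h : Cdeg (true, false, i, j, k) = n
  · rw [mC_of h]
    simp [Cd, CdTarget, Cterm1, Cterm2, Cterm3, Cterm4]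
  · rw [mC_ne h]; simp

lemma Cd_tt (n i j k : ℕ) : Cd n (mC n (true, true, i, j, k)) =
    (1 / 2 : ℚ) • mC (n + 1) (true, false, i, j + 2, k)
      - mC (n + 1) (true, false, i + 1, j, k + 1) := by
  by_cases h : Cdeg (true, true, i, j, k) = n
  · rw [mC_of h, mC_of (by simp [Cdeg] at h ⊢; omega), mC_of (by simp [Cdeg] at h ⊢; omega)]
    simp [Cd, CdTarget, Cterm1, Cterm2, Cterm3, Cterm4, sub_eq_add_neg]
  · rw [mC_ne h, mC_ne (by simp [Cdeg] at h ⊢; omega), mC_ne (by simp [Cdeg] at h ⊢; omega)]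
    simp

/-- the part of the differential coming from `ω₄`, `ω₆`. -/
def T (n : ℕ) (β : Bool) (i j k : ℕ) : CV n :=
  (j : ℚ) • mC n (true, β, i + 1, j - 1, k) + (k : ℚ) • mC n (true, β, i, j + 1, k - 1)

lemma Cterm34 (n : ℕ) (β : Bool) (i j k : ℕ) (h : Cdeg (false, β, i, j, k) = n) :
    Cterm3 n ⟨(false, β, i, j, k), h⟩ + Cterm4 n ⟨(false, β, i, j, k), h⟩
      = T (n + 1) β i j k := by
  unfold T
  congr 1
  · cases j with
    | zero => simp [Cterm3]
    | succ j => 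
      rw [mC_of (by simp [Cdeg] at h ⊢; omega)]
      simp [Cterm3]
  · cases k with
    | zero => simp [Cterm4]
    | succ k => 
      rw [mC_of (by simp [Cdeg] at h ⊢; omega)]
      simp [Cterm4]

lemma T_ne (n : ℕ) (β : Bool) (i j k : ℕ) (h : Cdeg (false, β, i, j, k) ≠ n) :
    T (n + 1) β i j k = 0 := by
  unfold T
  cases j <;> cases k <;> try simp only [Nat.cast_zero, zero_smul, zero_add, add_zero]
  · rw [mC_ne (by simp [Cdeg] at h ⊢; omega)]; simp
  · rw [mC_ne (by simp [Cdeg] at h ⊢; omega)]; simp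
  · rw [mC_ne (by simp [Cdeg] at h ⊢; omega), mC_ne (by simp [Cdeg] at h ⊢; omega)]; simp

lemma Cd_ff (n i j k : ℕ) : Cd n (mC n (false, false, i, j, k)) = T (n + 1) false i j k := by
  by_cases h : Cdeg (false, false, i, j, k) = n
  · rw [mC_of h, ← Cterm34 n false i j k h]
    simp [Cd, CdTarget, Cterm1, Cterm2]
  · rw [mC_ne h, T_ne _ _ _ _ _ h]; simp

lemma Cd_ft (n i j k : ℕ) : Cd n (mC n (false, true, i, j, k)) =
    -((1 / 2 : ℚ) • mC (n + 1) (false, false, i, j + 2, k))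
      + mC (n + 1) (false, false, i + 1, j, k + 1) + T (n + 1) true i j k := by
  by_cases h : Cdeg (false, true, i, j, k) = n
  · rw [mC_of h, ← Cterm34 n true i j k h, mC_of (by simp [Cdeg] at h ⊢; omega),
      mC_of (by simp [Cdeg] at h ⊢; omega)]
    simp [Cd, CdTarget, Cterm1, Cterm2, add_assoc]
  · rw [mC_ne h, T_ne _ _ _ _ _ h, mC_ne (by simp [Cdeg] at h ⊢; omega),
      mC_ne (by simp [Cdeg] at h ⊢; omega)]
    simp

lemma Cd_Cd (n : ℕ) (x : CV n) : Cd (n + 1) (Cd n x) = 0 := by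
  refine C_ext ((Cd (n + 1)).comp (Cd n)) 0 ?_ x
  rintro ⟨_ | _, _ | _, i, j, k⟩
  · simp [Cd_ff, T, Cd_tf]
  · simp only [LinearMap.comp_apply, Cd_ft, T, map_add, map_neg, map_smul, Cd_ff, Cd_tt,
      LinearMap.zero_apply]
    rcases j with _ | j <;> rcases k with _ | k <;> simp <;> module
  · simp [Cd_tf]
  · simp [Cd_tt, Cd_tf]

lemma rho_t (n : ℕ) (α : Bool) (i j k : ℕ) : rho n (mC n (α, true, i, j, k)) = 0 := by
  by_cases h : Cdeg (α, true, i, j, k) = n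
  · rw [mC_of h]; simp [rho, rhoTarget]
  · rw [mC_ne h]; simp

lemma rho_even (n : ℕ) (α : Bool) (i l k : ℕ) : rho n (mC n (α, false, i, 2 * l, k)) =
    (2 : ℚ) ^ l • mS n (false, α, i + l, k + l) := by
  by_cases h : Cdeg (α, false, i, 2 * l, k) = n
  · rw [mC_of h, mS_of (by simp [Cdeg, Sdeg] at h ⊢; omega)]; simp [rho, rhoTarget]
  · rw [mC_ne h, mS_ne (by simp [Cdeg, Sdeg] at h ⊢; omega)]; simp

lemma rho_odd (n : ℕ) (α : Bool) (i l k : ℕ) : rho n (mC n (α, false, i, 2 * l + 1, k)) =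
    (2 : ℚ) ^ l • mS n (true, α, i + l, k + l) := by
  have h2 : (2 * l + 1) / 2 = l := by omega
  by_cases h : Cdeg (α, false, i, 2 * l + 1, k) = n
  · rw [mC_of h, mS_of (by simp [Cdeg, Sdeg] at h ⊢; omega)]; simp [rho, rhoTarget, h2]
  · rw [mC_ne h, mS_ne (by simp [Cdeg, Sdeg] at h ⊢; omega)]; simp

lemma Sd_t (n : ℕ) (e : Bool) (j m : ℕ) : Sd n (mS n (e, true, j, m)) = 0 := by
  by_cases h : Sdeg (e, true, j, m) = n
  · rw [mS_of h]; cases e <;> simp [Sd, SdTarget]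
  · rw [mS_ne h]; simp

lemma Sd_f (n : ℕ) (j m : ℕ) : Sd n (mS n (false, false, j, m)) =
    (m : ℚ) • mS (n + 1) (true, true, j, m - 1) := by
  by_cases h : Sdeg (false, false, j, m) = n
  · rw [mS_of h]
    cases m with
    | zero => simp [Sd, SdTarget]
    | succ m => 
      rw [mS_of (by simp [Sdeg] at h ⊢; omega)]
      simp [Sd, SdTarget]
  · rw [mS_ne h]
    cases m with
    | zero => simp
    | succ m => rw [mS_ne (by simp [Sdeg] at h ⊢; omega)]; simp

lemma Sd_tr (n : ℕ) (j m : ℕ) : Sd n (mS n (true, false, j, m)) =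
    (2 * (m : ℚ) + 1) • mS (n + 1) (false, true, j + 1, m) := by
  by_cases h : Sdeg (true, false, j, m) = n
  · rw [mS_of h, mS_of (by simp [Sdeg] at h ⊢; omega)]
    simp [Sd, SdTarget]
  · rw [mS_ne h, mS_ne (by simp [Sdeg] at h ⊢; omega)]; simp

lemma rho_Cd (n : ℕ) (x : CV n) : rho (n + 1) (Cd n x) = Sd n (rho n x) := by
  refine C_ext ((rho (n + 1)).comp (Cd n)) ((Sd n).comp (rho n)) ?_ x
  rintro ⟨α, β, i, j, k⟩
  simp only [LinearMap.comp_apply]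
  obtain ⟨l, rfl | rfl⟩ : ∃ l, j = 2 * l ∨ j = 2 * l + 1 := ⟨j / 2, by omega⟩
  · cases α <;> cases β
    · rw [Cd_ff, rho_even, map_smul, Sd_f, T, map_add, map_smul, map_smul, rho_odd]
      have h1 : ((2 * l : ℕ) : ℚ) • rho (n + 1) (mC (n + 1) (true, false, i + 1, 2 * l - 1, k))
          = ((l : ℚ) * 2 ^ l) • mS (n + 1) (true, true, i + l, k + l - 1) := by
        cases l with
        | zero => simp
        | succ l =>
          have : 2 * (l + 1) - 1 = 2 * l + 1 := by omega
          rw [this, rho_odd, smul_smul]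
          have e1 : i + 1 + l = i + (l + 1) := by omega
          have e2 : k + (l + 1) - 1 = k + l := by omega
          rw [e1, e2]; congr 1; push_cast; ring
      rw [h1]
      cases k with
      | zero => simp [smul_smul, mul_comm]
      | succ k =>
        have e2 : k + 1 + l - 1 = k + l := by omega
        simp only [e2, Nat.add_sub_cancel]
        push_cast
        module
    · rw [Cd_ft, rho_t, T]
      have := rho_even (n + 1) false i (l + 1) k
      rw [show 2 * (l + 1) = 2 * l + 2 by ring] at this
      simp only [map_add, map_neg, map_smul, rho_t, this, rho_even]
      rw [show i + 1 + l = i + (l + 1) by omega, show k + 1 + l = k + (l + 1) by omega]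
      simp only [map_zero, pow_succ]
      module
    · rw [Cd_tf, rho_even, map_smul, Sd_t]; simp
    · rw [Cd_tt, rho_t]
      have := rho_even (n + 1) true i (l + 1) k
      rw [show 2 * (l + 1) = 2 * l + 2 by ring] at this
      simp only [map_sub, map_smul, this, rho_even]
      rw [show i + 1 + l = i + (l + 1) by omega, show k + 1 + l = k + (l + 1) by omega]
      simp only [map_zero, pow_succ]
      module
  · cases α <;> cases β
    · rw [Cd_ff, rho_odd, map_smul, Sd_tr, T, map_add, map_smul, map_smul]
      rw [Nat.add_sub_cancel, rho_even]
      have h1 : (k : ℚ) • rho (n + 1) (mC (n + 1) (true, false, i, 2 * l + 1 + 1, k - 1))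
          = ((k : ℚ) * 2 ^ (l + 1)) • mS (n + 1) (false, true, i + l + 1, k + l) := by
        cases k with
        | zero => simp
        | succ k =>
          rw [show 2 * l + 1 + 1 = 2 * (l + 1) by ring, rho_even, smul_smul, Nat.add_sub_cancel,
            show k + (l + 1) = k + 1 + l by omega, add_assoc i]
      rw [h1, show i + 1 + l = i + l + 1 by omega, pow_succ]
      push_cast
      module
    · rw [Cd_ft, rho_t, T]
      have := rho_odd (n + 1) false i (l + 1) k
      rw [show 2 * (l + 1) + 1 = 2 * l + 1 + 2 by ring] at this
      simp only [map_add, map_neg, map_smul, rho_t, this, rho_odd]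
      rw [show i + 1 + l = i + (l + 1) by omega, show k + 1 + l = k + (l + 1) by omega]
      simp only [map_zero, pow_succ]
      module
    · rw [Cd_tf, rho_odd, map_smul, Sd_t]; simp
    · rw [Cd_tt, rho_t]
      have := rho_odd (n + 1) true i (l + 1) k
      rw [show 2 * (l + 1) + 1 = 2 * l + 1 + 2 by ring] at this
      simp only [map_sub, map_smul, this, rho_odd]
      rw [show i + 1 + l = i + (l + 1) by omega, show k + 1 + l = k + (l + 1) by omega]
      simp only [map_zero, pow_succ]
      module

/-- The section of `ρ`. -/
def sig (n : ℕ) : SV n →ₗ[ℚ] CV n :=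
  Finsupp.linearCombination ℚ
    (fun b : SB n => mC n (b.1.2.1, false, b.1.2.2.1, b.1.1.toNat, b.1.2.2.2))

lemma sig_mS (n : ℕ) (e α : Bool) (j m : ℕ) :
    sig n (mS n (e, α, j, m)) = mC n (α, false, j, e.toNat, m) := by
  by_cases h : Sdeg (e, α, j, m) = n
  · rw [mS_of h]; simp [sig]
  · rw [mS_ne h, mC_ne (by simp [Cdeg, Sdeg] at h ⊢; omega)]; simp

lemma rho_sig (n : ℕ) (y : SV n) : rho n (sig n y) = y := by
  refine S_ext ((rho n).comp (sig n)) LinearMap.id ?_ y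
  rintro ⟨_ | _, α, j, m⟩
  · simpa [sig_mS] using rho_even n α j 0 m
  · simpa [sig_mS] using rho_odd n α j 0 m

/-- The span of the monomials divisible by `h₇`. -/
def H (n : ℕ) : Submodule ℚ (CV n) :=
  Submodule.span ℚ (Set.range fun p : Bool × ℕ × ℕ × ℕ => mC n (p.1, true, p.2))

lemma mem_H (n : ℕ) (α : Bool) (i j k : ℕ) : mC n (α, true, i, j, k) ∈ H n :=
  Submodule.subset_span ⟨(α, i, j, k), rfl⟩

lemma T_mem_H (n i j k : ℕ) : T n true i j k ∈ H n :=
  add_mem (Submodule.smul_mem _ _ (mem_H _ _ _ _ _)) (Submodule.smul_mem _ _ (mem_H _ _ _ _ _))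

/-- Division by `ω₂ω₆ − ½ω₄²`, times `h₇`. -/
def Q (n : ℕ) (α : Bool) : ℕ → ℕ → ℕ → CV n
  | i, j + 2, k => (if α then (2 : ℚ) else -2) • mC n (α, true, i, j, k)
      + (2 : ℚ) • Q n α (i + 1) j (k + 1)
  | _, 0, _ => 0
  | _, 1, _ => 0

lemma Q_ne (n : ℕ) (α : Bool) (i j k : ℕ) (h : Cdeg (α, false, i, j, k) ≠ n + 1) :
    Q n α i j k = 0 := by
  induction j using Nat.twoStepInduction generalizing i k with
  | zero => rw [Q]
  | one => rw [Q]
  | more j ih _ =>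
    rw [Q, ih _ _ (by simp [Cdeg] at h ⊢; omega), mC_ne (by simp [Cdeg] at h ⊢; omega)]
    simp

/-- The homotopy. -/
def sh (n : ℕ) : CV (n + 1) →ₗ[ℚ] CV n :=
  Finsupp.linearCombination ℚ (fun b : CB (n + 1) =>
    if b.1.2.1 then 0 else Q n b.1.1 b.1.2.2.1 b.1.2.2.2.1 b.1.2.2.2.2)

lemma sh_t (n : ℕ) (α : Bool) (i j k : ℕ) : sh n (mC (n + 1) (α, true, i, j, k)) = 0 := by
  by_cases h : Cdeg (α, true, i, j, k) = n + 1
  · rw [mC_of h]; simp [sh]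
  · rw [mC_ne h]; simp

lemma sh_f (n : ℕ) (α : Bool) (i j k : ℕ) :
    sh n (mC (n + 1) (α, false, i, j, k)) = Q n α i j k := by
  by_cases h : Cdeg (α, false, i, j, k) = n + 1
  · rw [mC_of h]; simp [sh]
  · rw [mC_ne h, Q_ne _ _ _ _ _ h]; simp

lemma sh_Cd (n : ℕ) (x : CV n) (hx : x ∈ H n) : sh n (Cd n x) = x := by
  have : Set.EqOn ((sh n).comp (Cd n)) (LinearMap.id : CV n →ₗ[ℚ] CV n) (H n) := by
    refine LinearMap.eqOn_span' ?_
    rintro _ ⟨⟨_ | _, i, j, k⟩, rfl⟩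
    · simp only [LinearMap.comp_apply, Cd_ft, T, map_add, map_neg, map_smul, sh_f, sh_t, Q,
        LinearMap.id_apply]
      simp only [Bool.false_eq_true, if_false]
      module
    · simp only [LinearMap.comp_apply, Cd_tt, map_sub, map_smul, sh_f, Q,
        LinearMap.id_apply]
      simp only [if_true]
      module
  exact this hx

lemma decomp_aux (n : ℕ) (α : Bool) (i j k : ℕ) :
    mC (n + 1) (α, false, i, j, k) - sig (n + 1) (rho (n + 1) (mC (n + 1) (α, false, i, j, k)))
      ∈ H (n + 1) ⊔ (H n).map (Cd n) := by
  induction j using Nat.twoStepInduction generalizing i k with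
  | zero =>
    have := rho_even (n + 1) α i 0 k
    simp at this
    simp [this, sig_mS]
  | one =>
    have := rho_odd (n + 1) α i 0 k
    simp at this
    simp [this, sig_mS]
  | more j ih _ =>
    have hK : ∃ w ∈ H (n + 1) ⊔ (H n).map (Cd n), mC (n + 1) (α, false, i, j + 2, k) =
        (2 : ℚ) • mC (n + 1) (α, false, i + 1, j, k + 1) + w := by
      have hm := Submodule.mem_sup_right (S := H (n + 1))
        (Submodule.mem_map_of_mem (f := Cd n) (mem_H n α i j k))
      cases α
      · refine ⟨(2 : ℚ) • T (n + 1) true i j k - (2 : ℚ) • Cd n (mC n (false, true, i, j, k)),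
          sub_mem (Submodule.smul_mem _ _ (Submodule.mem_sup_left (T_mem_H _ _ _ _)))
            (Submodule.smul_mem _ _ hm), ?_⟩
        rw [Cd_ft]; module
      · refine ⟨(2 : ℚ) • Cd n (mC n (true, true, i, j, k)), Submodule.smul_mem _ _ hm, ?_⟩
        rw [Cd_tt]; module
    obtain ⟨w, hw, e⟩ := hK
    have hr : rho (n + 1) w = 0 := by
      have hle : H (n + 1) ⊔ (H n).map (Cd n) ≤ LinearMap.ker (rho (n + 1)) := by
        have h1 : ∀ m, H m ≤ LinearMap.ker (rho m) := by
          intro m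
          refine Submodule.span_le.2 ?_
          rintro _ ⟨p, rfl⟩
          exact rho_t ..
        refine sup_le (h1 _) ?_
        rintro _ ⟨v, hv, rfl⟩
        have := h1 _ hv
        rw [LinearMap.mem_ker] at this ⊢
        rw [rho_Cd, this, map_zero]
      exact hle hw
    rw [e, map_add, hr, add_zero, map_smul, map_smul]
    have := add_mem (Submodule.smul_mem _ (2 : ℚ) (ih (i + 1) (k + 1))) hw
    convert this using 1
    module

lemma decomp (n : ℕ) (x : CV (n + 1)) :
    x - sig (n + 1) (rho (n + 1) x) ∈ H (n + 1) ⊔ (H n).map (Cd n) := by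
  induction x using C_ind with
  | h0 => simp
  | ha x y hx hy =>
    convert add_mem hx hy using 1
    simp only [map_add]; abel
  | hs c x hx =>
    convert Submodule.smul_mem _ c hx using 1
    simp only [map_smul, smul_sub]
  | hm q =>
    obtain ⟨α, _ | _, i, j, k⟩ := q
    · exact decomp_aux _ _ _ _ _
    · rw [rho_t, map_zero, sub_zero]
      exact Submodule.mem_sup_left (mem_H _ _ _ _ _)

/-- The kernel of `ρ` is acyclic. -/
lemma acyclic (n : ℕ) (x : CV (n + 1)) (hd : Cd (n + 1) x = 0) (hr : rho (n + 1) x = 0) :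
    ∃ t ∈ H n, x = Cd n t := by
  have := decomp n x
  rw [hr, map_zero, sub_zero] at this
  obtain ⟨u, hu, w, ⟨v, hv, rfl⟩, rfl⟩ := Submodule.mem_sup.1 this
  have h : u = 0 := by
    rw [map_add, Cd_Cd, add_zero] at hd
    rw [← sh_Cd _ u hu, hd, map_zero]
  exact ⟨v, hv, by rw [h, zero_add]⟩

lemma rho_H (n : ℕ) (x : CV n) (hx : x ∈ H n) : rho n x = 0 := by
  have : H n ≤ LinearMap.ker (rho n) := by
    refine Submodule.span_le.2 ?_
    rintro _ ⟨p, rfl⟩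
    exact rho_t ..
  exact this hx

lemma surj (n : ℕ) (y : SV n) (hy : Sd n y = 0) : ∃ x : CV n, Cd n x = 0 ∧ rho n x = y := by
  obtain ⟨t, ht, e⟩ := acyclic n (Cd n (sig n y)) (Cd_Cd ..) (by rw [rho_Cd, rho_sig, hy])
  refine ⟨sig n y - t, by rw [map_sub, e, sub_self], ?_⟩
  rw [map_sub, rho_sig, rho_H _ _ ht, sub_zero]

lemma inj0 (x : CV 0) (hx : rho 0 x = 0) : x = 0 := by
  have : sig 0 (rho 0 x) = x := by
    refine C_ext ((sig 0).comp (rho 0)) LinearMap.id ?_ x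
    rintro ⟨α, β, i, j, k⟩
    by_cases h : Cdeg (α, β, i, j, k) = 0
    · have hα : α = false := by cases α <;> simp [Cdeg] at h ⊢
      have hβ : β = false := by cases β <;> simp [Cdeg] at h ⊢
      have hj : j = 0 := by simp [Cdeg] at h; omega
      subst hα hβ hj
      have := rho_even 0 false i 0 k
      simp at this
      simp [this, sig_mS]
    · rw [mC_ne h]; simp
  rw [← this, hx, map_zero]

/-- The differential of `C` preserves the (degreewise) kernel of
`ρ`, i.e. the ideal generated by `h₇` and `ω₂ω₆ − ½ω₄²`; and `ρ : C → S` is a cochain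
map and a quasi-isomorphism: it induces an isomorphism `Hⁿ(C) → Hⁿ(S)` for every `n`
(in negative degrees both complexes vanish). -/
theorem statement11 :
    -- the differential of `C` preserves the ideal `ker ρ`
    (∀ (n : ℕ) (x : CV n), rho n x = 0 → rho (n + 1) (Cd n x) = 0) ∧
    -- `ρ` is a cochain map
    (∀ (n : ℕ) (x : CV n), rho (n + 1) (Cd n x) = Sd n (rho n x)) ∧
    -- surjectivity on `H⁰`
    (∀ y : SV 0, Sd 0 y = 0 → ∃ x : CV 0, Cd 0 x = 0 ∧ rho 0 x = y) ∧
    -- injectivity on `H⁰`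
    (∀ x : CV 0, Cd 0 x = 0 → rho 0 x = 0 → x = 0) ∧
    -- surjectivity on `H^{n+1}`
    (∀ (n : ℕ) (y : SV (n + 1)), Sd (n + 1) y = 0 →
      ∃ x : CV (n + 1), Cd (n + 1) x = 0 ∧ ∃ s : SV n, rho (n + 1) x = y + Sd n s) ∧
    -- injectivity on `H^{n+1}`
    (∀ (n : ℕ) (x : CV (n + 1)), Cd (n + 1) x = 0 →
      (∃ s : SV n, rho (n + 1) x = Sd n s) → ∃ t : CV n, x = Cd n t) := by
  refine ⟨?_, rho_Cd, surj 0, fun x _ h => inj0 x h, ?_, ?_⟩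
  · intro n x h
    rw [rho_Cd, h, map_zero]
  · intro n y hy
    obtain ⟨x, h1, h2⟩ := surj (n + 1) y hy
    exact ⟨x, h1, 0, by rw [h2, map_zero, add_zero]⟩
  · rintro n x hx ⟨s, hs⟩
    obtain ⟨t, -, e⟩ := acyclic n (x - Cd n (sig n s)) (by rw [map_sub, hx, Cd_Cd, sub_zero])
      (by rw [map_sub, rho_Cd, rho_sig, hs, sub_self])
    exact ⟨t + sig n s, by rw [map_add, ← e, sub_add_cancel]⟩

end Stmt11
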